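/- (Super/sub-homogeneity of SlideVaR.) Let X be an integrable random variable with X ≥ 0 almost surely and let λ ∈ ℝ. If λ ≥ 1 then SlideVaR_{α,β}^φ(λX) ≥ λ·SlideVaR_{α,β}^φ(X), and if 0 ≤ λ ≤ 1 then SlideVaR_{α,β}^φ(λX) ≤ λ·SlideVaR_{α,β}^φ(X); that is, SlideVaR increases non-linearly with the scale of the loss. -/

import Mathlib

open MeasureTheory

/-- Quantile function `F_X^{-1}(p) = inf {x : F_X(x) >= p}` of the loss `X` under `P`. -/
noncomputable def quantile {Ω : Type*} [MeasurableSpace Ω] (P : Measure Ω)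
    (X : Ω → ℝ) (p : ℝ) : ℝ :=
  sInf {x : ℝ | p ≤ (P {ω | X ω ≤ x}).toReal}

/-- Tail thickness `U_β^φ(X) = ∫_0^1 F_X^{-1}(p) φ_β(p) dp`. -/
noncomputable def tailThickness {Ω : Type*} [MeasurableSpace Ω] (P : Measure Ω)
    (φ : ℝ → ℝ) (X : Ω → ℝ) : ℝ :=
  ∫ p in (0:ℝ)..1, quantile P X p * φ p

/-- Value at risk `VaR_α(X) = F_X^{-1}(α)`. -/
noncomputable def VaR {Ω : Type*} [MeasurableSpace Ω] (P : Measure Ω)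
    (α : ℝ) (X : Ω → ℝ) : ℝ :=
  quantile P X α

/-- Conditional value at risk `CVaR_α(X) = (1/(1-α)) ∫_α^1 F_X^{-1}(p) dp`. -/
noncomputable def CVaR {Ω : Type*} [MeasurableSpace Ω] (P : Measure Ω)
    (α : ℝ) (X : Ω → ℝ) : ℝ :=
  (1 / (1 - α)) * ∫ p in α..1, quantile P X p

/-- `SlideVaR_{α,β}^φ(X) = S(U_β^φ(X))·CVaR_α(X) + (1 - S(U_β^φ(X)))·VaR_β(X)`. -/
noncomputable def SlideVaR {Ω : Type*} [MeasurableSpace Ω] (P : Measure Ω)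
    (α β : ℝ) (φ S : ℝ → ℝ) (X : Ω → ℝ) : ℝ :=
  S (tailThickness P φ X) * CVaR P α X
    + (1 - S (tailThickness P φ X)) * VaR P β X

section Quantile

open scoped Pointwise

variable {Ω : Type*} [MeasurableSpace Ω] {P : Measure Ω} {X : Ω → ℝ}

theorem nonneg_of_mem_quantile_set (hX0 : ∀ᵐ ω ∂P, 0 ≤ X ω) {p x : ℝ} (hp : 0 < p)
    (hx : p ≤ (P {ω | X ω ≤ x}).toReal) : 0 ≤ x := by
  by_contra! hneg
  have hnull : P {ω | X ω ≤ x} = 0 :=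
    measure_mono_null (fun ω (hω : X ω ≤ x) ↦ not_le.2 (hω.trans_lt hneg)) hX0
  rw [hnull, ENNReal.toReal_zero] at hx
  exact hx.not_gt hp

theorem quantile_nonneg (hX0 : ∀ᵐ ω ∂P, 0 ≤ X ω) (p : ℝ) : 0 ≤ quantile P X p := by
  rcases le_or_gt p 0 with hp | hp
  · have huniv : {x : ℝ | p ≤ (P {ω | X ω ≤ x}).toReal} = Set.univ :=
      Set.eq_univ_of_forall fun x ↦ hp.trans ENNReal.toReal_nonneg
    simp [quantile, huniv]
  · exact Real.sInf_nonneg fun x hx ↦ nonneg_of_mem_quantile_set hX0 hp hx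

theorem quantile_le_of_le (hX0 : ∀ᵐ ω ∂P, 0 ≤ X ω) {p x : ℝ} (hp : 0 < p)
    (hx : p ≤ (P {ω | X ω ≤ x}).toReal) : quantile P X p ≤ x :=
  csInf_le ⟨0, fun _ hy ↦ nonneg_of_mem_quantile_set hX0 hp hy⟩ hx

theorem exists_le_measure_le [IsProbabilityMeasure P] (X : Ω → ℝ) {p : ℝ} (hp : p < 1) :
    ∃ x : ℝ, p ≤ (P {ω | X ω ≤ x}).toReal := by
  have hmono : Monotone fun n : ℕ ↦ {ω | X ω ≤ n} := fun m n hmn ω (hω : X ω ≤ m) ↦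
    hω.trans (Nat.cast_le.2 hmn)
  have huniv : ⋃ n : ℕ, {ω | X ω ≤ n} = Set.univ :=
    Set.eq_univ_of_forall fun ω ↦ Set.mem_iUnion.2 (exists_nat_ge (X ω))
  have hlim := tendsto_measure_iUnion_atTop (μ := P) hmono
  rw [huniv, measure_univ] at hlim
  have hlim' := (ENNReal.tendsto_toReal ENNReal.one_ne_top).comp hlim
  obtain ⟨n, hn⟩ := (hlim'.eventually_const_lt (by simpa using hp)).exists
  exact ⟨n, hn.le⟩

theorem quantile_monotoneOn [IsProbabilityMeasure P] (hX0 : ∀ᵐ ω ∂P, 0 ≤ X ω) :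
    MonotoneOn (quantile P X) (Set.Ioo 0 1) := fun _ hp _ hq hpq ↦
  le_csInf (exists_le_measure_le X hq.2) fun _ hx ↦ quantile_le_of_le hX0 hp.1 (hpq.trans hx)

theorem quantile_const_mul {l : ℝ} (hl : 0 < l) (p : ℝ) :
    quantile P (fun ω ↦ l * X ω) p = l * quantile P X p := by
  rw [quantile, quantile, ← smul_eq_mul, ← Real.sInf_smul_of_nonneg hl.le]
  congr 1
  ext x
  rw [Set.mem_smul_set_iff_inv_smul_mem₀ hl.ne']
  simp only [Set.mem_ofPred_eq, smul_eq_mul, le_inv_mul_iff₀ hl]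

theorem quantile_zero [IsProbabilityMeasure P] {p : ℝ} (hp : 0 < p) (hp1 : p ≤ 1) :
    quantile P (fun _ ↦ 0) p = 0 :=
  (quantile_le_of_le (by simp) hp (by simpa using hp1)).antisymm (quantile_nonneg (by simp) p)

theorem volume_quantile_gt_le [IsProbabilityMeasure P] (hX0 : ∀ᵐ ω ∂P, 0 ≤ X ω) (t : ℝ) :
    volume.restrict (Set.Ioo (0 : ℝ) 1) {p | t < quantile P X p} ≤ P {ω | t < X ω} := by
  rw [Measure.restrict_apply' measurableSet_Ioo]
  have hsub : {p | t < quantile P X p} ∩ Set.Ioo (0 : ℝ) 1 ⊆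
      Set.Ioo (P {ω | X ω ≤ t}).toReal 1 := fun p ⟨hpt, hp⟩ ↦
    ⟨not_le.1 fun h ↦ (quantile_le_of_le hX0 hp.1 h).not_gt hpt, hp.2⟩
  refine (measure_mono hsub).trans ?_
  rw [Real.volume_Ioo, ENNReal.ofReal_sub _ ENNReal.toReal_nonneg, ENNReal.ofReal_one,
    ENNReal.ofReal_toReal (measure_ne_top _ _), tsub_le_iff_left, ← measure_univ (μ := P)]
  refine (measure_mono fun ω _ ↦ ?_).trans (measure_union_le _ _)
  exact le_or_gt (X ω) t

theorem integrableOn_quantile [IsProbabilityMeasure P] (hX : Integrable X P)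
    (hX0 : ∀ᵐ ω ∂P, 0 ≤ X ω) : IntegrableOn (quantile P X) (Set.Ioo 0 1) := by
  have hmeas : AEMeasurable (quantile P X) (volume.restrict (Set.Ioo 0 1)) :=
    aemeasurable_restrict_of_monotoneOn measurableSet_Ioo (quantile_monotoneOn hX0)
  have hq0 : 0 ≤ᵐ[volume.restrict (Set.Ioo 0 1)] quantile P X := ae_of_all _ (quantile_nonneg hX0)
  refine ⟨hmeas.aestronglyMeasurable, (hasFiniteIntegral_iff_ofReal hq0).2 ?_⟩
  refine lt_of_le_of_lt ?_ ((hasFiniteIntegral_iff_ofReal hX0).1 hX.2)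
  rw [lintegral_eq_lintegral_meas_lt _ hq0 hmeas,
    lintegral_eq_lintegral_meas_lt _ hX0 hX.aemeasurable]
  exact lintegral_mono fun t ↦ volume_quantile_gt_le hX0 t

theorem VaR_le_CVaR [IsProbabilityMeasure P] (hX : Integrable X P) (hX0 : ∀ᵐ ω ∂P, 0 ≤ X ω)
    {α β : ℝ} (hβ : 0 < β) (hβα : β ≤ α) (hα : α < 1) : VaR P β X ≤ CVaR P α X := by
  have hint : IntervalIntegrable (quantile P X) volume α 1 := by
    rw [intervalIntegrable_iff_integrableOn_Ioo_of_le hα.le]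
    exact (integrableOn_quantile hX hX0).mono_set (Set.Ioo_subset_Ioo_left (hβ.le.trans hβα))
  have hle : ∫ _ in α..1, quantile P X β ≤ ∫ p in α..1, quantile P X p :=
    intervalIntegral.integral_mono_on_of_le_Ioo hα.le intervalIntegrable_const hint
      fun p hp ↦ quantile_monotoneOn hX0 ⟨hβ, hβα.trans_lt hα⟩
        ⟨hβ.trans_le (hβα.trans hp.1.le), hp.2⟩ (hβα.trans hp.1.le)
  rw [intervalIntegral.integral_const, smul_eq_mul] at hle
  rw [VaR, CVaR, one_div, le_inv_mul_iff₀ (sub_pos.2 hα)]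
  exact hle

theorem tailThickness_nonneg (hX0 : ∀ᵐ ω ∂P, 0 ≤ X ω) {φ : ℝ → ℝ}
    (hφ : ∀ p ∈ Set.Icc (0 : ℝ) 1, 0 ≤ φ p) : 0 ≤ tailThickness P φ X :=
  intervalIntegral.integral_nonneg zero_le_one fun p hp ↦
    mul_nonneg (quantile_nonneg hX0 p) (hφ p hp)

theorem tailThickness_const_mul {l : ℝ} (hl : 0 < l) (φ : ℝ → ℝ) :
    tailThickness P φ (fun ω ↦ l * X ω) = l * tailThickness P φ X := by
  simp_rw [tailThickness, quantile_const_mul hl, mul_assoc, intervalIntegral.integral_const_mul]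

theorem SlideVaR_const_mul {l : ℝ} (hl : 0 < l) (α β : ℝ) (φ S : ℝ → ℝ) :
    SlideVaR P α β φ S (fun ω ↦ l * X ω) =
      l * (VaR P β X + S (l * tailThickness P φ X) * (CVaR P α X - VaR P β X)) := by
  simp_rw [SlideVaR, tailThickness_const_mul hl, CVaR, VaR, quantile_const_mul hl,
    intervalIntegral.integral_const_mul]
  ring

theorem SlideVaR_zero [IsProbabilityMeasure P] {α β : ℝ} (hβ : 0 < β) (hβα : β ≤ α)
    (hα : α < 1) (φ S : ℝ → ℝ) : SlideVaR P α β φ S (fun _ ↦ 0) = 0 := by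
  have hCVaR : ∫ p in α..1, quantile P (fun _ ↦ 0) p = 0 := by
    refine (intervalIntegral.integral_congr fun p hp ↦ ?_).trans intervalIntegral.integral_zero
    rw [Set.uIcc_of_le hα.le] at hp
    exact quantile_zero (hβ.trans_le (hβα.trans hp.1)) hp.2
  rw [SlideVaR, CVaR, VaR, hCVaR, quantile_zero hβ (hβα.trans hα.le)]
  ring

end Quantile

theorem slideVaR_homogeneity
    {Ω : Type*} [MeasurableSpace Ω] (P : Measure Ω) [IsProbabilityMeasure P]
    (α β : ℝ) (hβ : 0 < β) (hβα : β ≤ α) (hα : α < 1) (φ : ℝ → ℝ)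
    (hφ0 : ∀ p ∈ Set.Ico (0:ℝ) β, φ p = 0)
    (hφpos : ∀ p ∈ Set.Icc β 1, 0 ≤ φ p)
    (hφmono : MonotoneOn φ (Set.Icc β 1))
    (hφnorm : ∫ p in (0:ℝ)..1, φ p = 1)
    (S : ℝ → ℝ) (hS : Monotone S) (hS01 : ∀ x, S x ∈ Set.Icc (0:ℝ) 1)
    (X : Ω → ℝ) (hX : Integrable X P) (hX0 : ∀ᵐ ω ∂P, 0 ≤ X ω) (l : ℝ) :
    (1 ≤ l → l * SlideVaR P α β φ S X ≤ SlideVaR P α β φ S (fun ω => l * X ω)) ∧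
    (0 ≤ l → l ≤ 1 → SlideVaR P α β φ S (fun ω => l * X ω) ≤ l * SlideVaR P α β φ S X) := by
  have hU : 0 ≤ tailThickness P φ X := by
    refine tailThickness_nonneg hX0 fun p hp ↦ ?_
    rcases lt_or_ge p β with h | h
    · exact (hφ0 p ⟨hp.1, h⟩).ge
    · exact hφpos p ⟨h, hp.2⟩
  have hVC : 0 ≤ CVaR P α X - VaR P β X := sub_nonneg.2 (VaR_le_CVaR hX hX0 hβ hβα hα)
  have hSlide : SlideVaR P α β φ S X =
      VaR P β X + S (tailThickness P φ X) * (CVaR P α X - VaR P β X) := by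
    rw [SlideVaR]
    ring
  refine ⟨fun hl ↦ ?_, fun hl0 hl1 ↦ ?_⟩
  · have hl0 : 0 < l := one_pos.trans_le hl
    rw [SlideVaR_const_mul hl0, hSlide]
    gcongr
    exact hS (le_mul_of_one_le_left hU hl)
  · rcases hl0.eq_or_lt with rfl | hl0
    · simp only [zero_mul]
      exact (SlideVaR_zero hβ hβα hα φ S).le
    · rw [SlideVaR_const_mul hl0, hSlide]
      gcongr
      exact hS (mul_le_of_le_one_left hU hl1)
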